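/- arXiv:1605.09601 — 3 statements merged into one kernel-verified Lean document; each statement's English description precedes it below -/
import Mathlib

section
/- Let ρ > 1, Q > 0, s > 0, and let integers M ≤ N be given with N ≥ 1. Let f be given on [-1, (ρ+ρ⁻¹)/2) by a Chebyshev series f(x) = Σ_{n≥0} a_n T_n(x) with |a_0| ≤ Q and |a_n| ≤ 2Q ρ^{-n} for n ≥ 1. Let ε_vec be a random vector in ℝ^{N+1} with independent Gaussian coordinates of mean 0 and variance s², let c = (AᵀA)^{-1} Aᵀ (f(x^{equi}) + ε_vec) with A = T_M(x^{equi}), and set p_M(x) = Σ_{k=0}^M c_k T_k(x). Then for every x with 1 ≤ x < (ρ+ρ⁻¹)/2, writing r = (x + √(x²−1))/ρ, E[ |f(x) − p_M(x)| ] ≤ 2Q [ (N+1)^{1/2}(M+1) / (σ_{M+1}(A)(ρ−1)) + r/(1−r) ] r^M + ((M+1)^{3/2} s / σ_{M+1}(A)) (ρ r)^M. -/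
open Matrix MeasureTheory
open scoped BigOperators

/-- Chebyshev polynomial of the first kind `T_n`, as a function `ℝ → ℝ`. -/
noncomputable def cheb (n : ℕ) (x : ℝ) : ℝ :=
  (Polynomial.Chebyshev.T ℝ (n : ℤ)).eval x

/-- The equally spaced grid `x_k = 2k/N - 1`, `k = 0, …, N`, on `[-1,1]`. -/
noncomputable def xequi (N : ℕ) (k : Fin (N + 1)) : ℝ :=
  2 * (k : ℝ) / (N : ℝ) - 1

/-- The `(N+1) × (M+1)` Chebyshev–Vandermonde matrix at the equally spaced grid. -/
noncomputable def chebVand (N M : ℕ) : Matrix (Fin (N + 1)) (Fin (M + 1)) ℝ :=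
  Matrix.of fun i j => cheb (j : ℕ) (xequi N i)

/-- The Euclidean norm of a vector in `ℝ^n`. -/
noncomputable def enorm2 {n : ℕ} (v : Fin n → ℝ) : ℝ :=
  Real.sqrt (∑ i, (v i) ^ 2)

/-- The smallest singular value of a matrix, as the infimum of `‖A v‖₂` over unit vectors. -/
noncomputable def sigmaMin {m n : ℕ} (A : Matrix (Fin m) (Fin n) ℝ) : ℝ :=
  sInf {r | ∃ v : Fin n → ℝ, enorm2 v = 1 ∧ r = enorm2 (A.mulVec v)}

/-- The largest singular value of a matrix, as the supremum of `‖A v‖₂` over unit vectors. -/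
noncomputable def sigmaMax {m n : ℕ} (A : Matrix (Fin m) (Fin n) ℝ) : ℝ :=
  sSup {r | ∃ v : Fin n → ℝ, enorm2 v = 1 ∧ r = enorm2 (A.mulVec v)}

/-- The law of a vector of `N+1` independent mean-zero Gaussians of variance `s²`. -/
noncomputable def gaussVec (N : ℕ) (s : ℝ) : Measure (Fin (N + 1) → ℝ) :=
  Measure.pi fun _ => ProbabilityTheory.gaussianReal 0 ⟨s ^ 2, sq_nonneg s⟩


theorem enorm2_nonneg {n : ℕ} (v : Fin n → ℝ) : 0 ≤ enorm2 v := Real.sqrt_nonneg _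

theorem enorm2_sq {n : ℕ} (v : Fin n → ℝ) : enorm2 v ^ 2 = ∑ i, v i ^ 2 :=
  Real.sq_sqrt (Finset.sum_nonneg fun i _ => sq_nonneg (v i))

theorem enorm2_eq_norm {n : ℕ} (v : Fin n → ℝ) : enorm2 v = ‖WithLp.toLp 2 v‖ := by
  simp [enorm2, EuclideanSpace.norm_eq]

theorem enorm2_smul {n : ℕ} (c : ℝ) (v : Fin n → ℝ) : enorm2 (c • v) = |c| * enorm2 v := by
  simp [enorm2_eq_norm, norm_smul]

theorem enorm2_eq_zero {n : ℕ} {v : Fin n → ℝ} : enorm2 v = 0 ↔ v = 0 := by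
  simp [enorm2_eq_norm]

theorem abs_dotProduct_le_enorm2_mul {n : ℕ} (v w : Fin n → ℝ) :
    |v ⬝ᵥ w| ≤ enorm2 v * enorm2 w := by
  refine abs_le_of_sq_le_sq ?_ (mul_nonneg (enorm2_nonneg v) (enorm2_nonneg w))
  rw [mul_pow, enorm2_sq, enorm2_sq]
  exact Finset.sum_mul_sq_le_sq_mul_sq _ _ _

theorem enorm2_le_of_abs_le {n : ℕ} {v : Fin n → ℝ} {b : ℝ} (hb : 0 ≤ b) (h : ∀ i, |v i| ≤ b) :
    enorm2 v ≤ √n * b := by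
  rw [enorm2, ← Real.sqrt_sq hb, ← Real.sqrt_mul (Nat.cast_nonneg n)]
  refine Real.sqrt_le_sqrt ?_
  calc ∑ i, v i ^ 2 ≤ ∑ _i : Fin n, b ^ 2 :=
        Finset.sum_le_sum fun i _ => sq_le_sq.mpr ((h i).trans (le_abs_self b))
    _ = n * b ^ 2 := by simp

theorem sigmaMin_mul_enorm2_le {m n : ℕ} (A : Matrix (Fin m) (Fin n) ℝ) (v : Fin n → ℝ) :
    sigmaMin A * enorm2 v ≤ enorm2 (A *ᵥ v) := by
  rcases eq_or_ne (enorm2 v) 0 with h | h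
  · rw [h, mul_zero]
    exact enorm2_nonneg _
  have hpos : 0 < enorm2 v := (enorm2_nonneg v).lt_of_ne' h
  rw [← le_div_iff₀ hpos]
  refine csInf_le ⟨0, ?_⟩ ⟨(enorm2 v)⁻¹ • v, ?_, ?_⟩
  · rintro _ ⟨w, -, rfl⟩
    exact enorm2_nonneg _
  · rw [enorm2_smul, abs_of_pos (inv_pos.mpr hpos), inv_mul_cancel₀ h]
  · rw [Matrix.mulVec_smul, enorm2_smul, abs_of_pos (inv_pos.mpr hpos), div_eq_inv_mul]

theorem sigmaMin_pos {m n : ℕ} (A : Matrix (Fin m) (Fin (n + 1)) ℝ)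
    (hA : ∀ v, A *ᵥ v = 0 → v = 0) : 0 < sigmaMin A := by
  obtain ⟨K, hK, hlip⟩ := LinearMap.exists_antilipschitzWith
    (Matrix.toEuclideanLin (𝕜 := ℝ) A) (by
      rw [LinearMap.ker_eq_bot']
      intro v hv
      have h := hA (WithLp.ofLp v) (by simpa using congrArg WithLp.ofLp hv)
      simpa using congrArg (WithLp.toLp 2) h)
  refine (inv_pos.mpr (NNReal.coe_pos.mpr hK)).trans_le (le_csInf ?_ ?_)
  · refine ⟨_, Pi.single 0 1, ?_, rfl⟩
    simp [enorm2_eq_norm]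
  · rintro _ ⟨v, hv, rfl⟩
    have h := hlip.le_mul_dist (WithLp.toLp 2 v) 0
    rw [map_zero, dist_zero_right, dist_zero_right, Matrix.toLpLin_toLp, ← enorm2_eq_norm,
      hv, ← enorm2_eq_norm] at h
    rwa [inv_le_iff_one_le_mul₀' (NNReal.coe_pos.mpr hK)]

theorem isUnit_det_transpose_mul_self {m n : ℕ} (A : Matrix (Fin m) (Fin n) ℝ)
    (hA : ∀ v, A *ᵥ v = 0 → v = 0) : IsUnit (Aᵀ * A).det := by
  rw [isUnit_iff_ne_zero, ne_eq, ← Matrix.exists_mulVec_eq_zero_iff]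
  rintro ⟨v, hv0, hv⟩
  refine hv0 (hA v (dotProduct_self_eq_zero.mp ?_))
  rw [← Matrix.mulVec_mulVec] at hv
  rw [Matrix.dotProduct_mulVec, ← Matrix.mulVec_transpose, hv, zero_dotProduct]

/-- The functional `y ↦ t ⬝ A⁺ y` of a least squares fit is represented by a vector `w` of norm at
most `‖t‖ / σ_min(A)`, and it is exact on the range of `A`. -/
theorem exists_leastSquares_representer {m n : ℕ} (A : Matrix (Fin m) (Fin (n + 1)) ℝ)
    (hA : ∀ v, A *ᵥ v = 0 → v = 0) (t : Fin (n + 1) → ℝ) :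
    ∃ w : Fin m → ℝ, enorm2 w ≤ enorm2 t / sigmaMin A ∧
      (∀ y, (((Aᵀ * A)⁻¹ * Aᵀ) *ᵥ y) ⬝ᵥ t = w ⬝ᵥ y) ∧ ∀ c, w ⬝ᵥ (A *ᵥ c) = c ⬝ᵥ t := by
  have hdet := isUnit_det_transpose_mul_self A hA
  have hσ := sigmaMin_pos A hA
  have hsymm : ((Aᵀ * A)⁻¹)ᵀ = (Aᵀ * A)⁻¹ := by
    rw [Matrix.transpose_nonsing_inv, Matrix.transpose_mul, Matrix.transpose_transpose]
  set v := (Aᵀ * A)⁻¹ *ᵥ t with hv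
  have hGv : Aᵀ *ᵥ (A *ᵥ v) = t := by
    rw [Matrix.mulVec_mulVec, hv, Matrix.mulVec_mulVec, Matrix.mul_nonsing_inv _ hdet,
      Matrix.one_mulVec]
  have hadj : ∀ c, (A *ᵥ v) ⬝ᵥ (A *ᵥ c) = c ⬝ᵥ t := fun c => by
    rw [Matrix.dotProduct_mulVec, ← Matrix.mulVec_transpose, hGv, dotProduct_comm]
  refine ⟨A *ᵥ v, ?_, fun y => ?_, hadj⟩
  · rw [le_div_iff₀ hσ]
    have h1 := sigmaMin_mul_enorm2_le A v
    have h2 : enorm2 (A *ᵥ v) ^ 2 ≤ enorm2 v * enorm2 t := by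
      have h3 : enorm2 (A *ᵥ v) ^ 2 = v ⬝ᵥ t := by
        rw [← hadj, enorm2_sq]
        simp [dotProduct, sq]
      rw [h3]
      exact (le_abs_self _).trans (abs_dotProduct_le_enorm2_mul v t)
    rcases (enorm2_nonneg (A *ᵥ v)).eq_or_lt with h0 | h0
    · rw [← h0, zero_mul]
      exact enorm2_nonneg t
    · refine le_of_mul_le_mul_left ?_ h0
      calc enorm2 (A *ᵥ v) * (enorm2 (A *ᵥ v) * sigmaMin A)
          = sigmaMin A * enorm2 (A *ᵥ v) ^ 2 := by ring
        _ ≤ sigmaMin A * (enorm2 v * enorm2 t) := by gcongr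
        _ = sigmaMin A * enorm2 v * enorm2 t := by ring
        _ ≤ enorm2 (A *ᵥ v) * enorm2 t := mul_le_mul_of_nonneg_right h1 (enorm2_nonneg t)
  · rw [← Matrix.mulVec_mulVec, dotProduct_comm, Matrix.dotProduct_mulVec,
      ← Matrix.mulVec_transpose, hsymm, ← hv, Matrix.dotProduct_mulVec,
      Matrix.vecMul_transpose]

theorem xequi_injective {N : ℕ} (hN : 1 ≤ N) : Function.Injective (xequi N) := by
  intro i j h
  have hN' : (N : ℝ) ≠ 0 := by positivity
  have h' : (i : ℝ) = (j : ℝ) := by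
    simp only [xequi] at h
    field_simp at h
    linarith
  exact Fin.ext (by exact_mod_cast h')

theorem abs_xequi_le_one {N : ℕ} (hN : 1 ≤ N) (k : Fin (N + 1)) : |xequi N k| ≤ 1 := by
  have hN' : (0 : ℝ) < N := by exact_mod_cast hN
  have hk : (k : ℝ) ≤ N := by exact_mod_cast Fin.is_le k
  have h0 : 0 ≤ 2 * (k : ℝ) / N := by positivity
  have h2 : 2 * (k : ℝ) / N ≤ 2 := by
    rw [div_le_iff₀ hN']
    linarith
  rw [xequi, abs_le]
  constructor <;> linarith

theorem chebVand_mulVec_eq_zero {N M : ℕ} (hMN : M ≤ N) (hN : 1 ≤ N) (v : Fin (M + 1) → ℝ)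
    (hv : chebVand N M *ᵥ v = 0) : v = 0 := by
  set P : Polynomial ℝ :=
    ∑ k : Fin (M + 1), v k • Polynomial.Chebyshev.T ℝ ((k : ℕ) : ℤ) with hP
  have hP0 : P = 0 := by
    refine Polynomial.eq_zero_of_natDegree_lt_card_of_eval_eq_zero P (xequi_injective hN)
      (fun i => ?_) ?_
    · have h := congrFun hv i
      simp only [Matrix.mulVec, dotProduct, chebVand, Matrix.of_apply, cheb, Pi.zero_apply] at h
      rw [hP, Polynomial.eval_finsetSum, ← h]
      exact Finset.sum_congr rfl fun k _ => by
        rw [Polynomial.eval_smul, smul_eq_mul, mul_comm]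
    · rw [Fintype.card_fin]
      refine (Polynomial.natDegree_sum_le_of_forall_le (n := M) _ _ fun k _ => ?_).trans_lt
        (by omega)
      refine (Polynomial.natDegree_smul_le _ _).trans ?_
      simpa using Fin.is_le k
  have hli := (Polynomial.Chebyshev.chebyshevTsequence ℝ).linearIndependent.comp
    (fun k : Fin (M + 1) => (k : ℕ)) Fin.val_injective
  exact funext (Fintype.linearIndependent_iff.mp hli v hP0)

theorem abs_cheb_le_one (n : ℕ) {x : ℝ} (hx : |x| ≤ 1) : |cheb n x| ≤ 1 :=
  Polynomial.Chebyshev.abs_eval_T_real_le_one n hx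

theorem abs_cheb_le_pow (n : ℕ) {x : ℝ} (hx : 1 ≤ x) : |cheb n x| ≤ (x + √(x ^ 2 - 1)) ^ n := by
  have h0 : 0 ≤ Real.arcosh x := Real.arcosh_nonneg hx
  have h1 : cheb n x = Real.cosh (n * Real.arcosh x) := by
    rw [cheb]
    conv_lhs => rw [← Real.cosh_arcosh hx]
    rw [Polynomial.Chebyshev.T_real_cosh]
    simp
  rw [h1, abs_of_pos (Real.cosh_pos _), ← Real.exp_arcosh hx, ← Real.exp_nat_mul, Real.cosh_eq]
  have : Real.exp (-(n * Real.arcosh x)) ≤ Real.exp (n * Real.arcosh x) :=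
    Real.exp_le_exp.mpr (neg_le_self (by positivity))
  linarith

theorem add_sqrt_sq_sub_one_lt {ρ x : ℝ} (hρ : 1 < ρ) (hx : 1 ≤ x) (hxρ : x < (ρ + ρ⁻¹) / 2) :
    x + √(x ^ 2 - 1) < ρ := by
  have hρ0 : 0 < ρ := by linarith
  have hinv : ρ⁻¹ < 1 := inv_lt_one_of_one_lt₀ hρ
  have hmul : ρ * ρ⁻¹ = 1 := mul_inv_cancel₀ hρ0.ne'
  have hlt : √(x ^ 2 - 1) < (ρ - ρ⁻¹) / 2 := by
    rw [Real.sqrt_lt' (by linarith)]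
    nlinarith
  linarith

/-- Truncation error of a series dominated by a geometric one. -/
theorem abs_sub_sum_le_of_hasSum {u : ℕ → ℝ} {S C q : ℝ} (hu : HasSum u S) (hq0 : 0 ≤ q)
    (hq1 : q < 1) (hb : ∀ n, 1 ≤ n → |u n| ≤ C * q ^ n) (M : ℕ) :
    |S - ∑ k : Fin (M + 1), u k| ≤ C * (q ^ (M + 1) / (1 - q)) := by
  rw [Fin.sum_univ_eq_sum_range]
  refine ((hasSum_nat_add_iff' (M + 1)).mpr hu).norm_le_of_bounded
    (g := fun n => C * (q ^ (M + 1) * q ^ n)) ?_ fun n => ?_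
  · rw [div_eq_mul_inv]
    exact ((hasSum_geometric_of_lt_one hq0 hq1).mul_left _).mul_left _
  · rw [Real.norm_eq_abs, ← pow_add, add_comm (M + 1) n]
    exact hb _ (by omega)

theorem gaussVec_eq_pi (N : ℕ) (s : ℝ) : gaussVec N s =
    Measure.pi fun _ => ProbabilityTheory.gaussianReal 0 (s ^ 2).toNNReal := by
  rw [Real.toNNReal_of_nonneg (sq_nonneg s)]
  rfl

instance isProbabilityMeasure_gaussVec (N : ℕ) (s : ℝ) : IsProbabilityMeasure (gaussVec N s) := by
  rw [gaussVec_eq_pi]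
  infer_instance

theorem memLp_dotProduct_gaussVec (N : ℕ) (s : ℝ) (w : Fin (N + 1) → ℝ) :
    MemLp (fun e => w ⬝ᵥ e) 2 (gaussVec N s) := by
  rw [gaussVec_eq_pi]
  simp only [dotProduct]
  refine memLp_finsetSum _ fun i _ => MemLp.const_mul ?_ _
  exact (ProbabilityTheory.memLp_id_gaussianReal 2).comp_measurePreserving
    (measurePreserving_eval _ i)

theorem integral_abs_dotProduct_gaussVec_le (N : ℕ) {s : ℝ} (hs : 0 ≤ s)
    (w : Fin (N + 1) → ℝ) :
    ∫ e, |w ⬝ᵥ e| ∂(gaussVec N s) ≤ enorm2 w * s := by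
  have hL := memLp_dotProduct_gaussVec N s w
  have hmean : ∫ e, w ⬝ᵥ e ∂(gaussVec N s) = 0 := by
    rw [gaussVec_eq_pi]
    simp only [dotProduct]
    rw [integral_finsetSum]
    · refine Finset.sum_eq_zero fun i _ => ?_
      rw [integral_const_mul, integral_comp_eval (X := fun _ => ℝ) (f := fun y : ℝ => y) (by fun_prop),
        ProbabilityTheory.integral_id_gaussianReal, mul_zero]
    · intro i _
      refine Integrable.const_mul (integrable_eval ?_) _
      exact (ProbabilityTheory.memLp_id_gaussianReal 1).integrable le_rfl
  have hvar : ProbabilityTheory.variance (fun e => w ⬝ᵥ e) (gaussVec N s)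
      = (enorm2 w * s) ^ 2 := by
    have h := ProbabilityTheory.variance_sum_pi
      (μ := fun _ : Fin (N + 1) => ProbabilityTheory.gaussianReal 0 (s ^ 2).toNNReal)
      (X := fun i y => w i * y)
      fun i => (ProbabilityTheory.memLp_id_gaussianReal 2).const_mul (w i)
    have hfun : (∑ i : Fin (N + 1), fun e : Fin (N + 1) → ℝ => w i * e i)
        = fun e => w ⬝ᵥ e := by
      ext e
      simp [dotProduct]
    rw [hfun] at h
    rw [gaussVec_eq_pi, h, mul_pow, enorm2_sq, Finset.sum_mul]
    refine Finset.sum_congr rfl fun i _ => ?_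
    rw [ProbabilityTheory.variance_const_mul, ProbabilityTheory.variance_fun_id_gaussianReal,
      Real.coe_toNNReal _ (sq_nonneg s)]
  have hsq : ∫ e, (w ⬝ᵥ e) ^ 2 ∂(gaussVec N s) = (enorm2 w * s) ^ 2 := by
    rw [ProbabilityTheory.variance_eq_sub hL, hmean] at hvar
    simpa using hvar
  have habs := ProbabilityTheory.variance_eq_sub (X := fun e => |w ⬝ᵥ e|) hL.norm
  have hnn := ProbabilityTheory.variance_nonneg (fun e => |w ⬝ᵥ e|) (gaussVec N s)
  rw [habs] at hnn
  simp only [Pi.pow_apply, sq_abs, hsq] at hnn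
  exact le_of_abs_le (abs_le_of_sq_le_sq (by linarith) (mul_nonneg (enorm2_nonneg w) hs))

theorem integral_abs_sub_dotProduct_gaussVec_le (N : ℕ) {s : ℝ} (hs : 0 ≤ s)
    (w : Fin (N + 1) → ℝ) (d : ℝ) :
    ∫ e, |d - w ⬝ᵥ e| ∂(gaussVec N s) ≤ |d| + enorm2 w * s := by
  have hint : Integrable (fun e => w ⬝ᵥ e) (gaussVec N s) :=
    (memLp_dotProduct_gaussVec N s w).integrable (by norm_num)
  calc ∫ e, |d - w ⬝ᵥ e| ∂(gaussVec N s)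
      ≤ ∫ e, (|d| + |w ⬝ᵥ e|) ∂(gaussVec N s) :=
        integral_mono ((integrable_const d).sub hint).abs ((integrable_const _).add hint.abs)
          fun e => abs_sub d _
    _ = |d| + ∫ e, |w ⬝ᵥ e| ∂(gaussVec N s) := by
        rw [integral_add (integrable_const _) hint.abs]
        simp
    _ ≤ |d| + enorm2 w * s := by
        gcongr
        exact integral_abs_dotProduct_gaussVec_le N hs w

/-- **Corollary 6.2 of the paper**: extrapolation with Gaussian noise. With samples
perturbed by independent Gaussian noise of mean `0` and variance `s²`, the least
squares fit `p_M = Σ c_k T_k`, `c = (AᵀA)⁻¹Aᵀ(f(x^equi) + ε_vec)`,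
`A = T_M(x^equi)`, satisfies for `1 ≤ x < (ρ+ρ⁻¹)/2` and `r = (x+√(x²−1))/ρ`
`E[|f(x) − p_M(x)|] ≤ 2Q [√(N+1)(M+1)/(σ_{M+1}(A)(ρ−1)) + r/(1−r)] r^M
+ ((M+1)^{3/2} s/σ_{M+1}(A)) (ρr)^M`. -/
theorem gaussian_extrapolation (ρ Q s : ℝ) (hρ : 1 < ρ) (hQ : 0 < Q) (hs : 0 < s)
    (M N : ℕ) (hMN : M ≤ N) (hN : 1 ≤ N)
    (f : ℝ → ℝ) (a : ℕ → ℝ)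
    (hf : ∀ x ∈ Set.Ico (-1 : ℝ) ((ρ + ρ⁻¹) / 2),
      HasSum (fun n : ℕ => a n * cheb n x) (f x))
    (ha0 : |a 0| ≤ Q)
    (ha : ∀ n : ℕ, 1 ≤ n → |a n| ≤ 2 * Q * ρ ^ (-(n : ℤ))) :
    ∀ x ∈ Set.Ico (1 : ℝ) ((ρ + ρ⁻¹) / 2),
      ∫ e : Fin (N + 1) → ℝ,
          |f x - ∑ k : Fin (M + 1),
            ((((chebVand N M).transpose * chebVand N M)⁻¹ * (chebVand N M).transpose) *ᵥ
              (fun i => f (xequi N i) + e i)) k * cheb (k : ℕ) x| ∂(gaussVec N s) ≤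
        2 * Q * (Real.sqrt ((N : ℝ) + 1) * ((M : ℝ) + 1) /
              (sigmaMin (chebVand N M) * (ρ - 1)) +
            ((x + Real.sqrt (x ^ 2 - 1)) / ρ) / (1 - (x + Real.sqrt (x ^ 2 - 1)) / ρ)) *
          ((x + Real.sqrt (x ^ 2 - 1)) / ρ) ^ M +
        ((M : ℝ) + 1) ^ ((3 : ℝ) / 2) * s / sigmaMin (chebVand N M) *
          (ρ * ((x + Real.sqrt (x ^ 2 - 1)) / ρ)) ^ M := by
  rintro x ⟨hx1, hxρ⟩
  have hρ0 : 0 < ρ := by linarith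
  set A := chebVand N M with hA
  set u := x + √(x ^ 2 - 1) with hu
  have hu1 : 1 ≤ u := le_add_of_le_of_nonneg hx1 (Real.sqrt_nonneg _)
  have huρ : u < ρ := add_sqrt_sq_sub_one_lt hρ hx1 hxρ
  have hr0 : 0 ≤ u / ρ := by positivity
  have hr1 : u / ρ < 1 := (div_lt_one hρ0).mpr huρ
  have hinj : ∀ v, A *ᵥ v = 0 → v = 0 := chebVand_mulVec_eq_zero hMN hN
  have hσ : 0 < sigmaMin A := sigmaMin_pos A hinj
  set t : Fin (M + 1) → ℝ := fun k => cheb k x with ht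
  set c : Fin (M + 1) → ℝ := fun k => a k with hc
  obtain ⟨w, hw, hwfit, hwexact⟩ := exists_leastSquares_representer A hinj t
  have htail : |f x - c ⬝ᵥ t| ≤ 2 * Q * ((u / ρ) ^ (M + 1) / (1 - u / ρ)) := by
    refine abs_sub_sum_le_of_hasSum (hf x ⟨by linarith, hxρ⟩) hr0 hr1 (fun n hn => ?_) M
    rw [abs_mul, div_pow]
    calc |a n| * |cheb n x| ≤ 2 * Q * ρ ^ (-(n : ℤ)) * u ^ n := by
          gcongr
          exacts [ha n hn, abs_cheb_le_pow n hx1]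
      _ = 2 * Q * (u ^ n / ρ ^ n) := by
          rw [_root_.zpow_neg, zpow_natCast]
          ring
  have hinv1 : ρ⁻¹ < 1 := inv_lt_one_of_one_lt₀ hρ
  have hgrid : ∀ i, |f (xequi N i) - (A *ᵥ c) i|
      ≤ 2 * Q * (ρ⁻¹ ^ (M + 1) / (1 - ρ⁻¹)) := fun i => by
    have hxi := abs_xequi_le_one hN i
    have h1 : 1 < (ρ + ρ⁻¹) / 2 := by
      have : ρ * ρ⁻¹ = 1 := mul_inv_cancel₀ hρ0.ne'
      nlinarith
    have hAc : (A *ᵥ c) i = ∑ k : Fin (M + 1), a k * cheb k (xequi N i) := by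
      simp only [Matrix.mulVec, dotProduct, hA, chebVand, Matrix.of_apply, hc, mul_comm]
    rw [hAc]
    refine abs_sub_sum_le_of_hasSum (hf _ ⟨(abs_le.mp hxi).1, (abs_le.mp hxi).2.trans_lt h1⟩)
      (by positivity) hinv1 (fun n hn => ?_) M
    rw [abs_mul]
    calc |a n| * |cheb n (xequi N i)| ≤ 2 * Q * ρ ^ (-(n : ℤ)) * 1 := by
          gcongr
          exacts [ha n hn, abs_cheb_le_one n hxi]
      _ = 2 * Q * ρ⁻¹ ^ n := by
          rw [_root_.zpow_neg, zpow_natCast, inv_pow, mul_one]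
  set τ : Fin (N + 1) → ℝ := fun i => f (xequi N i) - (A *ᵥ c) i with hτ
  have hgeom0 : 0 ≤ ρ⁻¹ ^ (M + 1) / (1 - ρ⁻¹) :=
    div_nonneg (by positivity) (by linarith)
  have hτnorm : enorm2 τ ≤ √((N : ℝ) + 1) * (2 * Q * (ρ⁻¹ ^ (M + 1) / (1 - ρ⁻¹))) := by
    simpa using enorm2_le_of_abs_le (by positivity) hgrid
  have htnorm : enorm2 t ≤ √((M : ℝ) + 1) * u ^ M := by
    have h : ∀ k : Fin (M + 1), |t k| ≤ u ^ M := fun k =>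
      (abs_cheb_le_pow k hx1).trans (pow_le_pow_right₀ hu1 (Fin.is_le k))
    simpa using enorm2_le_of_abs_le (by positivity) h
  have hwnorm : enorm2 w ≤ √((M : ℝ) + 1) * u ^ M / sigmaMin A := hw.trans (by gcongr)
  have herr : ∀ e : Fin (N + 1) → ℝ,
      f x - ∑ k : Fin (M + 1), (((Aᵀ * A)⁻¹ * Aᵀ) *ᵥ (fun i => f (xequi N i) + e i)) k * cheb k x
        = (f x - c ⬝ᵥ t - w ⬝ᵥ τ) - w ⬝ᵥ e := fun e => by
    have hy : (fun i => f (xequi N i) + e i) = τ + A *ᵥ c + e := by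
      ext i
      simp [hτ]
    have h := hwfit (fun i => f (xequi N i) + e i)
    have hsum : ∑ k : Fin (M + 1),
        (((Aᵀ * A)⁻¹ * Aᵀ) *ᵥ (fun i => f (xequi N i) + e i)) k * cheb k x
          = w ⬝ᵥ (τ + A *ᵥ c + e) := by
      rw [← hy]
      exact h
    rw [hsum, dotProduct_add, dotProduct_add, hwexact]
    ring
  simp_rw [herr]
  refine (integral_abs_sub_dotProduct_gaussVec_le N hs.le w _).trans ?_
  have hM1 : (1 : ℝ) ≤ (M : ℝ) + 1 := by
    have : (0 : ℝ) ≤ M := Nat.cast_nonneg M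
    linarith
  have hsqrt : √((M : ℝ) + 1) ≤ (M : ℝ) + 1 := Real.sqrt_le_self_iff.mpr (Or.inr hM1)
  have hrpow : √((M : ℝ) + 1) ≤ ((M : ℝ) + 1) ^ ((3 : ℝ) / 2) := by
    rw [Real.sqrt_eq_rpow]
    exact Real.rpow_le_rpow_of_exponent_le hM1 (by norm_num)
  have hnoise : enorm2 w * s
      ≤ ((M : ℝ) + 1) ^ ((3 : ℝ) / 2) * s / sigmaMin A * (ρ * (u / ρ)) ^ M := by
    rw [mul_div_cancel₀ u hρ0.ne']
    calc enorm2 w * s ≤ ((M : ℝ) + 1) ^ ((3 : ℝ) / 2) * u ^ M / sigmaMin A * s := by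
          gcongr
          exact hwnorm.trans (by gcongr)
      _ = _ := by ring
  have hfit : |w ⬝ᵥ τ| ≤ 2 * Q * (√((N : ℝ) + 1) * ((M : ℝ) + 1) /
      (sigmaMin A * (ρ - 1))) * (u / ρ) ^ M := by
    calc |w ⬝ᵥ τ| ≤ enorm2 w * enorm2 τ := abs_dotProduct_le_enorm2_mul w τ
      _ ≤ (((M : ℝ) + 1) * u ^ M / sigmaMin A) *
          (√((N : ℝ) + 1) * (2 * Q * (ρ⁻¹ ^ (M + 1) / (1 - ρ⁻¹)))) := by
          gcongr
          · exact enorm2_nonneg τ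
          · exact hwnorm.trans (by gcongr)
      _ = _ := by
          have h1 : ρ - 1 ≠ 0 := by linarith
          have h2 : 1 - ρ⁻¹ = (ρ - 1) / ρ := by field_simp
          rw [h2, div_pow, inv_pow, pow_succ]
          field_simp
  calc |f x - c ⬝ᵥ t - w ⬝ᵥ τ| + enorm2 w * s
      ≤ |f x - c ⬝ᵥ t| + |w ⬝ᵥ τ| + enorm2 w * s := by
        gcongr
        exact abs_sub _ _
    _ ≤ 2 * Q * ((u / ρ) ^ (M + 1) / (1 - u / ρ)) +
        2 * Q * (√((N : ℝ) + 1) * ((M : ℝ) + 1) / (sigmaMin A * (ρ - 1))) * (u / ρ) ^ M +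
        ((M : ℝ) + 1) ^ ((3 : ℝ) / 2) * s / sigmaMin A * (ρ * (u / ρ)) ^ M := by
        gcongr
    _ = _ := by ring
end

section
/- Let M be a nonnegative integer and let S be the (M+1)×(M+1) upper-triangular change-of-basis matrix taking Legendre coefficients to Chebyshev coefficients, with entries S_{ij} = (1/π)Ψ(j/2)² if 0 = i ≤ j ≤ M with j even; S_{ij} = (2/π)Ψ((j−i)/2)Ψ((j+i)/2) if 0 < i ≤ j ≤ M with i+j even; and S_{ij} = 0 otherwise, where Ψ(t) = Γ(t+1/2)/Γ(t+1). Let S⁺ = (S + Sᵀ)/2 be the symmetric part of S. Then every eigenvalue λ of S⁺ satisfies |λ| ≤ 5/2, and consequently the spectral norm satisfies ‖S‖₂ ≤ 5. -/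
open Matrix MeasureTheory
open scoped BigOperators

/-- `Ψ(t) = Γ(t + 1/2)/Γ(t + 1)`. -/
noncomputable def PsiFun (t : ℝ) : ℝ := Real.Gamma (t + 1 / 2) / Real.Gamma (t + 1)

/-- The `(M+1) × (M+1)` upper-triangular change-of-basis matrix taking Legendre
coefficients to Chebyshev coefficients. -/
noncomputable def legToChebMat (M : ℕ) : Matrix (Fin (M + 1)) (Fin (M + 1)) ℝ :=
  Matrix.of fun i j =>
    if (i : ℕ) = 0 ∧ (j : ℕ) % 2 = 0 then
      1 / Real.pi * PsiFun ((j : ℝ) / 2) ^ 2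
    else if 0 < (i : ℕ) ∧ (i : ℕ) ≤ (j : ℕ) ∧ ((i : ℕ) + (j : ℕ)) % 2 = 0 then
      2 / Real.pi * PsiFun (((j : ℝ) - (i : ℝ)) / 2) * PsiFun (((j : ℝ) + (i : ℝ)) / 2)
    else 0

/-- The normalised central binomial coefficient `C(2n, n) / 4 ^ n`. -/
noncomputable def centralRatio (n : ℕ) : ℝ := (Nat.centralBinom n : ℝ) / 4 ^ n

lemma centralRatio_zero : centralRatio 0 = 1 := by simp [centralRatio]

lemma centralRatio_pos (n : ℕ) : 0 < centralRatio n := by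
  have h : (0 : ℝ) < Nat.centralBinom n := by exact_mod_cast Nat.centralBinom_pos n
  unfold centralRatio
  positivity

lemma centralRatio_succ (n : ℕ) :
    (2 * n + 2) * centralRatio (n + 1) = (2 * n + 1) * centralRatio n := by
  have h : ((n : ℝ) + 1) * (Nat.centralBinom (n + 1) : ℝ)
      = 2 * (2 * n + 1) * Nat.centralBinom n := by
    exact_mod_cast Nat.succ_mul_centralBinom_succ n
  unfold centralRatio
  rw [pow_succ]
  field_simp
  linarith

lemma centralRatio_one : centralRatio 1 = 1 / 2 := by
  have h := centralRatio_succ 0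
  simp only [centralRatio_zero, zero_add, CharP.cast_eq_zero] at h
  linarith

lemma centralRatio_antitone : Antitone centralRatio := by
  refine antitone_nat_of_succ_le fun n => ?_
  have h := centralRatio_succ n
  have h1 := centralRatio_pos n
  have h2 := centralRatio_pos (n + 1)
  have h3 : (0 : ℝ) ≤ n := n.cast_nonneg
  nlinarith

lemma PsiFun_natCast (n : ℕ) : PsiFun n = √Real.pi * centralRatio n := by
  induction n with
  | zero => simp [PsiFun, centralRatio_zero, ← Real.Gamma_one_half_eq]
  | succ n ih =>
    have h := centralRatio_succ n
    have hn : (0 : ℝ) ≤ n := n.cast_nonneg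
    have e : PsiFun ((n + 1 : ℕ) : ℝ) = ((n + 1 / 2) / (n + 1)) * PsiFun n := by
      unfold PsiFun
      push_cast
      rw [show (n : ℝ) + 1 + 1 / 2 = (n + 1 / 2) + 1 by ring,
        Real.Gamma_add_one (by positivity : (n : ℝ) + 1 / 2 ≠ 0),
        Real.Gamma_add_one (by positivity : (n : ℝ) + 1 ≠ 0), mul_div_mul_comm]
    rw [e, ih]
    field_simp
    linear_combination -h

lemma sum_centralRatio_mul_centralRatio (m : ℕ) :
    ∑ k ∈ Finset.range (m + 1), centralRatio k * centralRatio (m - k) = 1 := by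
  have key : ∀ m : ℕ, 2 * ∑ k ∈ Finset.range (m + 1),
      (k : ℝ) * (centralRatio k * centralRatio (m - k))
      = m * ∑ k ∈ Finset.range (m + 1), centralRatio k * centralRatio (m - k) := by
    intro m
    rw [two_mul]
    nth_rewrite 1 [← Finset.sum_range_reflect]
    rw [← Finset.sum_add_distrib, Finset.mul_sum]
    refine Finset.sum_congr rfl fun k hk => ?_
    have hk' : k ≤ m := Nat.lt_succ_iff.mp (Finset.mem_range.mp hk)
    rw [show m + 1 - 1 - k = m - k by lia, Nat.sub_sub_self hk', Nat.cast_sub hk']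
    ring
  induction m with
  | zero => simp [centralRatio_zero]
  | succ m ih =>
    have h1 := key (m + 1)
    have h0 := key m
    rw [Finset.sum_range_succ'] at h1
    have h2 : ∑ k ∈ Finset.range (m + 1), ((k + 1 : ℕ) : ℝ) *
        (centralRatio (k + 1) * centralRatio (m + 1 - (k + 1)))
        = ∑ k ∈ Finset.range (m + 1), (k : ℝ) * (centralRatio k * centralRatio (m - k))
          + 1 / 2 * ∑ k ∈ Finset.range (m + 1), centralRatio k * centralRatio (m - k) := by
      rw [Finset.mul_sum, ← Finset.sum_add_distrib]
      refine Finset.sum_congr rfl fun k _ => ?_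
      rw [Nat.add_sub_add_right]
      push_cast
      linear_combination (1 / 2 * centralRatio (m - k)) * centralRatio_succ k
    rw [h2, ih] at h1
    rw [ih] at h0
    push_cast at h1
    have hm : (m : ℝ) + 1 ≠ 0 := by positivity
    apply mul_left_cancel₀ hm
    linarith

lemma centralRatio_two_mul_le (m : ℕ) (hm : 1 ≤ m) :
    centralRatio (2 * m) ≤ 3 / 4 * centralRatio m := by
  induction m, hm using Nat.le_induction with
  | base =>
    have h := centralRatio_succ 1
    rw [centralRatio_one] at *
    norm_num at h ⊢
    linarith
  | succ m hm ih =>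
    have h1 := centralRatio_succ (2 * m)
    have h2 := centralRatio_succ (2 * m + 1)
    have h3 := centralRatio_succ m
    have hp := centralRatio_pos (2 * m)
    have hm0 : (0 : ℝ) ≤ m := m.cast_nonneg
    rw [show 2 * (m + 1) = 2 * m + 1 + 1 by ring]
    push_cast at h1 h2
    have e1 : centralRatio (2 * m + 1 + 1)
        = (4 * m + 1) * (4 * m + 3) / ((4 * m + 2) * (4 * m + 4)) * centralRatio (2 * m) := by
      field_simp
      linear_combination (4 * m + 2) * h2 + (4 * m + 3) * h1
    have e2 : centralRatio (m + 1) = (2 * m + 1) / (2 * m + 2) * centralRatio m := by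
      field_simp
      linear_combination h3
    have hc : ((4 * m + 1) * (4 * m + 3) / ((4 * m + 2) * (4 * m + 4)) : ℝ)
        ≤ (2 * m + 1) / (2 * m + 2) := by
      rw [div_le_div_iff₀ (by positivity) (by positivity)]
      nlinarith
    rw [e1, e2]
    calc _ ≤ (2 * m + 1) / (2 * m + 2) * centralRatio (2 * m) := by gcongr
      _ ≤ (2 * m + 1) / (2 * m + 2) * (3 / 4 * centralRatio m) := by gcongr
      _ = _ := by ring

lemma centralRatio_le_half (i : ℕ) (hi : 1 ≤ i) :
    centralRatio i ≤ 3 / 4 * centralRatio (i / 2) := by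
  rcases Nat.eq_zero_or_pos (i / 2) with h | h
  · obtain rfl : i = 1 := by lia
    norm_num [centralRatio_zero, centralRatio_one]
  · exact (centralRatio_antitone (by lia : 2 * (i / 2) ≤ i)).trans (centralRatio_two_mul_le _ h)

lemma centralRatio_diff_antitone :
    Antitone fun n => centralRatio n - centralRatio (n + 1) := by
  refine antitone_nat_of_succ_le fun n => ?_
  have h1 := centralRatio_succ n
  have h2 := centralRatio_succ (n + 1)
  have hp := centralRatio_pos (n + 1)
  have hq := centralRatio_antitone (Nat.le_succ n)
  have hn : (0 : ℝ) ≤ n := n.cast_nonneg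
  push_cast at h2
  simp only [Nat.succ_eq_add_one] at hq
  nlinarith

lemma two_mul_centralRatio_le (k m : ℕ) :
    2 * centralRatio (k + m) ≤ centralRatio k + centralRatio (k + 2 * m) := by
  induction m generalizing k with
  | zero => simp [two_mul]
  | succ m ih =>
    have h := ih (k + 1)
    have hd := centralRatio_diff_antitone (by lia : k ≤ k + 1 + 2 * m)
    simp only at hd
    rw [show k + (m + 1) = k + 1 + m by ring, show k + 2 * (m + 1) = k + 1 + 2 * m + 1 by ring]
    linarith

lemma mul_centralRatio_le_sum_odd (k m : ℕ) :
    (2 * m + 1) * centralRatio (k + m)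
      ≤ ∑ l ∈ Finset.range (2 * m + 1), centralRatio (k + l) := by
  induction m generalizing k with
  | zero => simp
  | succ m ih =>
    have h := ih (k + 1)
    have h2 := two_mul_centralRatio_le k (m + 1)
    rw [show 2 * (m + 1) + 1 = 2 * m + 1 + 1 + 1 by ring, Finset.sum_range_succ,
      Finset.sum_range_succ']
    have e : ∑ l ∈ Finset.range (2 * m + 1), centralRatio (k + (l + 1))
        = ∑ l ∈ Finset.range (2 * m + 1), centralRatio (k + 1 + l) :=
      Finset.sum_congr rfl fun l _ => by rw [add_right_comm, add_assoc]
    rw [e, add_zero, show k + (2 * m + 1 + 1) = k + 2 * (m + 1) by ring]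
    rw [show k + 1 + m = k + (m + 1) by ring] at h
    push_cast
    linarith

lemma mul_centralRatio_half_le_sum (k i : ℕ) :
    i * centralRatio (k + i / 2) ≤ ∑ l ∈ Finset.range i, centralRatio (k + l) := by
  have h := mul_centralRatio_le_sum_odd k (i / 2)
  rcases Nat.mod_two_eq_zero_or_one i with hi | hi
  · rw [Finset.sum_range_succ] at h
    have ha := centralRatio_antitone (by lia : k + i / 2 ≤ k + 2 * (i / 2))
    have hc : (i : ℝ) = 2 * ((i / 2 : ℕ) : ℝ) := by
      exact_mod_cast (by lia : i = 2 * (i / 2))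
    rw [show Finset.range i = Finset.range (2 * (i / 2)) by congr 1; lia, hc]
    linarith
  · have hc : (i : ℝ) = 2 * ((i / 2 : ℕ) : ℝ) + 1 := by
      exact_mod_cast (by lia : i = 2 * (i / 2) + 1)
    rw [show Finset.range i = Finset.range (2 * (i / 2) + 1) by congr 1; lia, hc]
    exact h

lemma mul_centralRatio_sq_le_one (n : ℕ) : (2 * n + 1) * centralRatio n ^ 2 ≤ 1 := by
  induction n with
  | zero => simp [centralRatio_zero]
  | succ n ih =>
    have h := centralRatio_succ n
    have hn : (0 : ℝ) ≤ n := n.cast_nonneg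
    have e : centralRatio (n + 1) = (2 * n + 1) / (2 * n + 2) * centralRatio n := by
      field_simp
      linear_combination h
    have hc : (2 * (n + 1) + 1) * (2 * n + 1) / (2 * n + 2) ^ 2 ≤ (1 : ℝ) := by
      rw [div_le_one (by positivity)]
      nlinarith
    rw [e]
    push_cast
    calc (2 * ((n : ℝ) + 1) + 1) * ((2 * n + 1) / (2 * n + 2) * centralRatio n) ^ 2
        = (2 * (n + 1) + 1) * (2 * n + 1) / (2 * n + 2) ^ 2
          * ((2 * n + 1) * centralRatio n ^ 2) := by field_simp
      _ ≤ 1 * 1 := by gcongr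
      _ = 1 := one_mul 1

lemma sum_centralRatio_le_inv_sub_inv (k i : ℕ) :
    ∑ l ∈ Finset.range i, centralRatio (k + l)
      ≤ (centralRatio (k + i))⁻¹ - (centralRatio k)⁻¹ := by
  induction i with
  | zero => simp
  | succ i ih =>
    have hs : ∀ n, centralRatio n ≤ (centralRatio (n + 1))⁻¹ - (centralRatio n)⁻¹ := by
      intro n
      have h := centralRatio_succ n
      have hn : (0 : ℝ) ≤ n := n.cast_nonneg
      have hp := centralRatio_pos n
      have e : (centralRatio (n + 1))⁻¹ - (centralRatio n)⁻¹
          = ((2 * n + 1) * centralRatio n)⁻¹ := by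
        have e' : centralRatio (n + 1) = (2 * n + 1) / (2 * n + 2) * centralRatio n := by
          field_simp
          linear_combination h
        rw [e']
        field_simp
        ring
      rw [e, le_inv_comm₀ hp (by positivity), ← one_div, le_div_iff₀ hp]
      have := mul_centralRatio_sq_le_one n
      nlinarith
    rw [Finset.sum_range_succ, ← add_assoc]
    linarith [hs (k + i)]

lemma sum_centralRatio_sub (i K : ℕ) :
    ∑ k ∈ Finset.range K, (centralRatio k - centralRatio (k + i)) ≤ 2 * i * centralRatio i := by
  have h : ∑ k ∈ Finset.range K, (centralRatio k - centralRatio (k + i))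
      = 2 * (K * centralRatio K - (K + i : ℕ) * centralRatio (K + i) + i * centralRatio i) := by
    induction K with
    | zero => simp
    | succ K ih =>
      rw [Finset.sum_range_succ, ih]
      have h1 := centralRatio_succ K
      have h2 := centralRatio_succ (K + i)
      rw [show K + 1 + i = K + i + 1 by ring]
      push_cast at h2 ⊢
      linarith
  have hm : Monotone fun n : ℕ => (n : ℝ) * centralRatio n := by
    refine monotone_nat_of_le_succ fun n => ?_
    have h1 := centralRatio_succ n
    have h2 := centralRatio_pos n
    push_cast
    linarith
  have h' := hm (by lia : K ≤ K + i)
  simp only at h'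
  rw [h]
  linarith

lemma sum_centralRatio_triple_le (i K : ℕ) (hi : 1 ≤ i) :
    ∑ k ∈ Finset.range K, centralRatio k * centralRatio (k + i) * centralRatio (k + i / 2)
      ≤ 2 * centralRatio i := by
  have hi' : (0 : ℝ) < i := by exact_mod_cast hi
  refine le_of_mul_le_mul_left ?_ hi'
  calc (i : ℝ) * ∑ k ∈ Finset.range K,
        centralRatio k * centralRatio (k + i) * centralRatio (k + i / 2)
      ≤ ∑ k ∈ Finset.range K, (centralRatio k - centralRatio (k + i)) := by
        rw [Finset.mul_sum]
        refine Finset.sum_le_sum fun k _ => ?_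
        have h := (mul_centralRatio_half_le_sum k i).trans (sum_centralRatio_le_inv_sub_inv k i)
        have h1 := centralRatio_pos k
        have h2 := centralRatio_pos (k + i)
        calc (i : ℝ) * (centralRatio k * centralRatio (k + i) * centralRatio (k + i / 2))
            = centralRatio k * centralRatio (k + i) * (i * centralRatio (k + i / 2)) := by ring
          _ ≤ centralRatio k * centralRatio (k + i)
              * ((centralRatio (k + i))⁻¹ - (centralRatio k)⁻¹) := by gcongr
          _ = centralRatio k - centralRatio (k + i) := by field_simp
    _ ≤ 2 * i * centralRatio i := sum_centralRatio_sub i K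
    _ = i * (2 * centralRatio i) := by ring

lemma sum_centralRatio_cube_le (K : ℕ) :
    ∑ k ∈ Finset.range K, centralRatio k ^ 3 ≤ 2 := by
  cases K with
  | zero => simp
  | succ K =>
    have h := sum_centralRatio_triple_le 1 K le_rfl
    rw [centralRatio_one] at h
    rw [Finset.sum_range_succ', centralRatio_zero]
    have h' : ∑ k ∈ Finset.range K, centralRatio (k + 1) ^ 3
        ≤ ∑ k ∈ Finset.range K,
          centralRatio k * centralRatio (k + 1) * centralRatio (k + 1 / 2) := by
      refine Finset.sum_le_sum fun k _ => ?_
      have h1 := centralRatio_antitone (Nat.le_succ k)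
      have h2 := centralRatio_pos (k + 1)
      have h3 := centralRatio_pos k
      calc centralRatio (k + 1) ^ 3
          = centralRatio (k + 1) * centralRatio (k + 1) * centralRatio (k + 1) := by ring
        _ ≤ _ := by
          gcongr
          exact centralRatio_antitone (by lia)
    linarith

/-- The entries of the Legendre-to-Chebyshev matrix in terms of `centralRatio`. -/
noncomputable def legToChebEntry (i j : ℕ) : ℝ :=
  if i ≤ j ∧ (i + j) % 2 = 0 then
    (if i = 0 then 1 else 2) * (centralRatio ((j - i) / 2) * centralRatio ((j + i) / 2))
  else 0

lemma legToChebMat_apply (M : ℕ) (i j : Fin (M + 1)) :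
    legToChebMat M i j = legToChebEntry i j := by
  obtain ⟨i, hi⟩ := i
  obtain ⟨j, hj⟩ := j
  have hpi : √Real.pi * √Real.pi = Real.pi := Real.mul_self_sqrt Real.pi_pos.le
  have hpi0 := Real.pi_ne_zero
  simp only [legToChebMat, Matrix.of_apply, legToChebEntry]
  by_cases h : i ≤ j ∧ (i + j) % 2 = 0
  · obtain ⟨k, rfl⟩ : ∃ k, j = i + 2 * k := ⟨(j - i) / 2, by lia⟩
    have e1 : (((i + 2 * k : ℕ) : ℝ) - i) / 2 = (k : ℕ) := by push_cast; ring
    have e2 : (((i + 2 * k : ℕ) : ℝ) + i) / 2 = (i + k : ℕ) := by push_cast; ring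
    rw [if_pos h, e1, e2, show (i + 2 * k - i) / 2 = k by lia,
      show (i + 2 * k + i) / 2 = i + k by lia, PsiFun_natCast, PsiFun_natCast]
    rcases Nat.eq_zero_or_pos i with rfl | h0
    · have e3 : (((0 + 2 * k : ℕ) : ℝ)) / 2 = (k : ℕ) := by push_cast; ring
      rw [if_pos (by lia), if_pos rfl, e3, PsiFun_natCast, zero_add, mul_pow, pow_two (√_), hpi]
      field_simp
    · rw [if_neg (by lia), if_pos ⟨h0, h⟩, if_neg (by lia)]
      field_simp
      linear_combination (centralRatio k * centralRatio (i + k)) * hpi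
  · rw [if_neg h, if_neg (by lia), if_neg (by lia)]

lemma legToChebEntry_nonneg (i j : ℕ) : 0 ≤ legToChebEntry i j := by
  unfold legToChebEntry
  have h1 := centralRatio_pos ((j - i) / 2)
  have h2 := centralRatio_pos ((j + i) / 2)
  split_ifs <;> positivity

lemma legToChebEntry_of_not {i j : ℕ} (h : ¬(i ≤ j ∧ (i + j) % 2 = 0)) :
    legToChebEntry i j = 0 := if_neg h

lemma legToChebEntry_zero (k : ℕ) :
    legToChebEntry 0 (2 * k) = centralRatio k * centralRatio k := by
  simp [legToChebEntry]

lemma legToChebEntry_le (i k : ℕ) :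
    legToChebEntry i (i + 2 * k) ≤ 2 * (centralRatio k * centralRatio (k + i)) := by
  have h1 := centralRatio_pos k
  have h2 := centralRatio_pos (k + i)
  unfold legToChebEntry
  rw [if_pos (by lia), show (i + 2 * k - i) / 2 = k by lia,
    show (i + 2 * k + i) / 2 = k + i by lia]
  gcongr
  split_ifs <;> norm_num

lemma sum_le_sum_comp {s t : Finset ℕ} {f : ℕ → ℝ} {g : ℕ → ℕ} (hf : ∀ n, 0 ≤ f n)
    (hst : ∀ n ∈ s, f n ≠ 0 → ∃ k ∈ t, g k = n) :
    ∑ n ∈ s, f n ≤ ∑ k ∈ t, f (g k) := by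
  classical
  calc ∑ n ∈ s, f n = ∑ n ∈ s with f n ≠ 0, f n := (Finset.sum_filter_ne_zero s).symm
    _ ≤ ∑ n ∈ t.image g, f n := by
      refine Finset.sum_le_sum_of_subset_of_nonneg (fun n hn => ?_) fun n _ _ => hf n
      rw [Finset.mem_filter] at hn
      exact Finset.mem_image.mpr (hst n hn.1 hn.2)
    _ ≤ ∑ k ∈ t, f (g k) := Finset.sum_image_le_of_nonneg fun n _ => hf _

lemma sum_row_le (N i : ℕ) :
    ∑ j ∈ Finset.range N, legToChebEntry i j * centralRatio (j / 2)
      ≤ 3 * centralRatio (i / 2) := by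
  refine (sum_le_sum_comp (t := Finset.range N) (g := fun k => i + 2 * k)
    (fun j => mul_nonneg (legToChebEntry_nonneg i j) (centralRatio_pos _).le) ?_).trans ?_
  · intro j hj hne
    have h : i ≤ j ∧ (i + j) % 2 = 0 := by
      by_contra h
      exact hne (by rw [legToChebEntry_of_not h, zero_mul])
    have := Finset.mem_range.mp hj
    exact ⟨(j - i) / 2, Finset.mem_range.mpr (by lia), by lia⟩
  · rcases Nat.eq_zero_or_pos i with rfl | hi
    · have h := sum_centralRatio_cube_le N
      have e : ∀ k, legToChebEntry 0 (0 + 2 * k) * centralRatio ((0 + 2 * k) / 2)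
          = centralRatio k ^ 3 := by
        intro k
        rw [zero_add, legToChebEntry_zero, show 2 * k / 2 = k by lia]
        ring
      simp only [e, Nat.zero_div, centralRatio_zero]
      linarith
    · calc ∑ k ∈ Finset.range N, legToChebEntry i (i + 2 * k) * centralRatio ((i + 2 * k) / 2)
          ≤ ∑ k ∈ Finset.range N,
            2 * (centralRatio k * centralRatio (k + i) * centralRatio (k + i / 2)) := by
            refine Finset.sum_le_sum fun k _ => ?_
            rw [show (i + 2 * k) / 2 = k + i / 2 by lia, ← mul_assoc 2]
            exact mul_le_mul_of_nonneg_right (legToChebEntry_le i k) (centralRatio_pos _).le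
        _ ≤ 2 * (2 * centralRatio i) := by
            rw [← Finset.mul_sum]
            gcongr
            exact sum_centralRatio_triple_le i N hi
        _ ≤ 3 * centralRatio (i / 2) := by linarith [centralRatio_le_half i hi]

lemma sum_col_le (N j : ℕ) :
    ∑ i ∈ Finset.range N, legToChebEntry i j * centralRatio (i / 2)
      ≤ 2 * centralRatio (j / 2) := by
  refine (sum_le_sum_comp (t := Finset.range (j / 2 + 1)) (g := fun k => j - 2 * k)
    (fun i => mul_nonneg (legToChebEntry_nonneg i j) (centralRatio_pos _).le) ?_).trans ?_
  · intro i _ hne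
    have h : i ≤ j ∧ (i + j) % 2 = 0 := by
      by_contra h
      exact hne (by rw [legToChebEntry_of_not h, zero_mul])
    exact ⟨(j - i) / 2, Finset.mem_range.mpr (by lia), by lia⟩
  · calc ∑ k ∈ Finset.range (j / 2 + 1),
          legToChebEntry (j - 2 * k) j * centralRatio ((j - 2 * k) / 2)
        ≤ ∑ k ∈ Finset.range (j / 2 + 1),
          2 * centralRatio (j / 2) * (centralRatio k * centralRatio (j / 2 - k)) := by
          refine Finset.sum_le_sum fun k hk => ?_
          have hk' := Finset.mem_range.mp hk
          have h := legToChebEntry_le (j - 2 * k) k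
          rw [show j - 2 * k + 2 * k = j by lia] at h
          have ha := centralRatio_antitone (by lia : j / 2 ≤ k + (j - 2 * k))
          have h0 := centralRatio_pos k
          have h1 := centralRatio_pos (j / 2 - k)
          rw [show (j - 2 * k) / 2 = j / 2 - k by lia]
          calc legToChebEntry (j - 2 * k) j * centralRatio (j / 2 - k)
              ≤ 2 * (centralRatio k * centralRatio (j / 2)) * centralRatio (j / 2 - k) := by
                gcongr
                exact h.trans (by gcongr)
            _ = _ := by ring
      _ = 2 * centralRatio (j / 2) := by
          rw [← Finset.mul_sum, sum_centralRatio_mul_centralRatio, mul_one]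

lemma abs_le_of_mulVec_eq_smul {ι : Type*} [Fintype ι] {A : Matrix ι ι ℝ} {w v : ι → ℝ}
    {c lam : ℝ} (hA : ∀ i j, 0 ≤ A i j) (hw : ∀ i, 0 < w i)
    (hrow : ∀ i, ∑ j, A i j * w j ≤ c * w i) (hv : v ≠ 0) (h : A *ᵥ v = lam • v) :
    |lam| ≤ c := by
  obtain ⟨i₁, hi₁⟩ := Function.ne_iff.mp hv
  obtain ⟨i, -, hi⟩ := Finset.exists_max_image Finset.univ (fun i => |v i| / w i) ⟨i₁, by simp⟩
  have hpos : 0 < |v i| / w i :=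
    (div_pos (abs_pos.mpr hi₁) (hw i₁)).trans_le (hi i₁ (Finset.mem_univ _))
  set r := |v i| / w i with hr
  have hvi : |v i| = r * w i := by rw [hr, div_mul_cancel₀ _ (hw i).ne']
  have hvj : ∀ j, |v j| ≤ r * w j := fun j =>
    (div_le_iff₀ (hw j)).mp (hi j (Finset.mem_univ _))
  have hi' : ∑ j, A i j * v j = lam * v i := congrFun h i
  refine le_of_mul_le_mul_right ?_ (mul_pos hpos (hw i))
  calc |lam| * (r * w i) = |∑ j, A i j * v j| := by rw [hi', abs_mul, hvi]
    _ ≤ ∑ j, |A i j * v j| := Finset.abs_sum_le_sum_abs _ _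
    _ ≤ ∑ j, r * (A i j * w j) := by
      refine Finset.sum_le_sum fun j _ => ?_
      rw [abs_mul, abs_of_nonneg (hA i j), mul_left_comm]
      exact mul_le_mul_of_nonneg_left (hvj j) (hA i j)
    _ ≤ r * (c * w i) := by
      rw [← Finset.mul_sum]
      exact mul_le_mul_of_nonneg_left (hrow i) hpos.le
    _ = c * (r * w i) := by ring

/-- The Schur test. -/
lemma sum_mulVec_sq_le {ι : Type*} [Fintype ι] {A : Matrix ι ι ℝ} {w : ι → ℝ}
    {a b : ℝ} (hA : ∀ i j, 0 ≤ A i j) (hw : ∀ i, 0 < w i) (ha : 0 ≤ a)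
    (hrow : ∀ i, ∑ j, A i j * w j ≤ a * w i) (hcol : ∀ j, ∑ i, A i j * w i ≤ b * w j)
    (v : ι → ℝ) : ∑ i, (A *ᵥ v) i ^ 2 ≤ a * b * ∑ i, v i ^ 2 := by
  have hnn : ∀ i j, 0 ≤ A i j * (v j ^ 2 / w j) := fun i j =>
    mul_nonneg (hA i j) (div_nonneg (sq_nonneg _) (hw j).le)
  calc ∑ i, (A *ᵥ v) i ^ 2
      ≤ ∑ i, (∑ j, A i j * w j) * ∑ j, A i j * (v j ^ 2 / w j) := by
        refine Finset.sum_le_sum fun i _ => ?_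
        refine Finset.sum_sq_le_sum_mul_sum_of_sq_le_mul _
          (fun j _ => mul_nonneg (hA i j) (hw j).le) (fun j _ => hnn i j) fun j _ => le_of_eq ?_
        have := (hw j).ne'
        field_simp
    _ ≤ ∑ i, (a * w i) * ∑ j, A i j * (v j ^ 2 / w j) := by
        refine Finset.sum_le_sum fun i _ => ?_
        exact mul_le_mul_of_nonneg_right (hrow i) (Finset.sum_nonneg fun j _ => hnn i j)
    _ = ∑ j, a * (v j ^ 2 / w j) * ∑ i, A i j * w i := by
        simp only [Finset.mul_sum]
        rw [Finset.sum_comm]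
        refine Finset.sum_congr rfl fun j _ => Finset.sum_congr rfl fun i _ => ?_
        ring
    _ ≤ ∑ j, a * (v j ^ 2 / w j) * (b * w j) := by
        refine Finset.sum_le_sum fun j _ => ?_
        exact mul_le_mul_of_nonneg_left (hcol j)
          (mul_nonneg ha (div_nonneg (sq_nonneg _) (hw j).le))
    _ = a * b * ∑ i, v i ^ 2 := by
        rw [Finset.mul_sum]
        refine Finset.sum_congr rfl fun j _ => ?_
        have := (hw j).ne'
        field_simp

/-- **Lemma A.4 of the paper**: every eigenvalue of the symmetric part
`S⁺ = (S + Sᵀ)/2` of the Legendre-to-Chebyshev change-of-basis matrix `S`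
satisfies `|λ| ≤ 5/2`, and consequently the spectral norm satisfies `‖S‖₂ ≤ 5`. -/
theorem legendre_to_chebyshev_norm_bound (M : ℕ) :
    (∀ (lam : ℝ) (v : Fin (M + 1) → ℝ), v ≠ 0 →
      ((1 / 2 : ℝ) • (legToChebMat M + (legToChebMat M).transpose)) *ᵥ v = lam • v →
      |lam| ≤ 5 / 2) ∧
    sigmaMax (legToChebMat M) ≤ 5 := by
  have hS : ∀ i j, 0 ≤ legToChebMat M i j := fun i j => by
    rw [legToChebMat_apply]
    exact legToChebEntry_nonneg _ _
  have hw : ∀ i : Fin (M + 1), 0 < centralRatio ((i : ℕ) / 2) := fun i => centralRatio_pos _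
  have hrow : ∀ i : Fin (M + 1), ∑ j : Fin (M + 1),
      legToChebMat M i j * centralRatio ((j : ℕ) / 2) ≤ 3 * centralRatio ((i : ℕ) / 2) := by
    intro i
    simp only [legToChebMat_apply]
    rw [Fin.sum_univ_eq_sum_range (fun j => legToChebEntry i j * centralRatio (j / 2))]
    exact sum_row_le _ _
  have hcol : ∀ j : Fin (M + 1), ∑ i : Fin (M + 1),
      legToChebMat M i j * centralRatio ((i : ℕ) / 2) ≤ 2 * centralRatio ((j : ℕ) / 2) := by
    intro j
    simp only [legToChebMat_apply]
    rw [Fin.sum_univ_eq_sum_range (fun i => legToChebEntry i j * centralRatio (i / 2))]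
    exact sum_col_le _ _
  constructor
  · intro lam v hv h
    refine abs_le_of_mulVec_eq_smul (w := fun i : Fin (M + 1) => centralRatio ((i : ℕ) / 2))
      (fun i j => ?_) hw (fun i => ?_) hv h
    · have h1 := hS i j
      have h2 := hS j i
      simp only [Matrix.smul_apply, Matrix.add_apply, Matrix.transpose_apply, smul_eq_mul]
      positivity
    · have h1 := hrow i
      have h2 := hcol i
      simp only [Matrix.smul_apply, Matrix.add_apply, Matrix.transpose_apply, smul_eq_mul,
        mul_assoc, add_mul, ← Finset.mul_sum, Finset.sum_add_distrib]
      linarith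
  · refine Real.sSup_le ?_ (by norm_num)
    rintro r ⟨v, hv, rfl⟩
    have h := sum_mulVec_sq_le hS hw (by norm_num) hrow hcol v
    have hv' : ∑ i, v i ^ 2 = 1 := by
      rw [enorm2, Real.sqrt_eq_one] at hv
      exact hv
    rw [hv'] at h
    rw [enorm2]
    refine Real.sqrt_le_iff.mpr ⟨by norm_num, ?_⟩
    linarith
end

section
/- Let N ≥ 4 be an integer and let m, n be nonnegative integers with (m+n)² ≤ 4N. Let x_k^{equi} = 2k/N − 1 for k = 0,…,N, and let P_m, P_n be Legendre polynomials. Define the trapezium-rule error E_{mn} = (2/N) Σ_{k=0}^N P_m(x_k^{equi}) P_n(x_k^{equi}) − (2/N) χ_{even}(m+n) − ∫_{-1}^1 P_m(x) P_n(x) dx, where χ_{even}(m+n) equals 1 if m+n is even and 0 if m+n is odd. Then |E_{mn}| ≤ 3(m+n)²/(π N²). -/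
open Matrix MeasureTheory
open scoped BigOperators

/-- The Legendre polynomials, via the three-term recurrence
`(n+2) P_{n+2} = (2n+3) x P_{n+1} - (n+1) P_n`, normalized so that `P_n(1) = 1`. -/
noncomputable def legendre : ℕ → Polynomial ℝ
  | 0 => 1
  | 1 => Polynomial.X
  | n + 2 =>
      Polynomial.C ((2 * (n : ℝ) + 3) / ((n : ℝ) + 2)) * (Polynomial.X * legendre (n + 1)) -
        Polynomial.C (((n : ℝ) + 1) / ((n : ℝ) + 2)) * legendre n

/-- The `(N+1) × (M+1)` Legendre–Vandermonde matrix at the equally spaced grid. -/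
noncomputable def legVand (N M : ℕ) : Matrix (Fin (N + 1)) (Fin (M + 1)) ℝ :=
  Matrix.of fun i j => (legendre (j : ℕ)).eval (xequi N i)

open Polynomial in
theorem sum_bernoulli_mul_choose_mul_pow (n M : ℕ) (hM : n < M) (y : ℝ) :
    ∑ j ∈ Finset.range M, (bernoulli j : ℝ) * (n.choose j : ℝ) * y ^ (n - j) =
      bernoulliFun n y := by
  have h : ∑ j ∈ Finset.range (n + 1), (bernoulli j : ℝ) * (n.choose j : ℝ) * y ^ (n - j) =
      bernoulliFun n y := by
    simp [bernoulliFun, Polynomial.bernoulli, eval_finsetSum, Polynomial.map_sum]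
  rw [← h]
  symm
  refine Finset.sum_subset (Finset.range_mono hM) fun j _ hj => ?_
  rw [Nat.choose_eq_zero_of_lt (by simpa using hj)]
  simp

theorem bernoulliFun_add_one (n : ℕ) (y : ℝ) :
    bernoulliFun n (y + 1) - bernoulliFun n y = n * y ^ (n - 1) := by
  have h := congrArg (fun p => (p.map (algebraMap ℚ ℝ)).eval y)
    (Polynomial.bernoulli_comp_one_add_X n)
  simp only [Polynomial.map_comp, Polynomial.eval_comp, Polynomial.map_add, Polynomial.map_one,
    Polynomial.map_X, Polynomial.eval_add, Polynomial.eval_one, Polynomial.eval_X,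
    nsmul_eq_mul, Polynomial.map_mul, Polynomial.map_natCast, Polynomial.map_pow,
    Polynomial.eval_mul, Polynomial.eval_natCast, Polynomial.eval_pow] at h
  rw [bernoulliFun, bernoulliFun, add_comm y, h]
  ring

open Polynomial in
/-- One step of the Euler–Maclaurin formula, which is exact on polynomials. -/
theorem euler_maclaurin_polynomial_step (F : ℝ[X]) (M : ℕ) (hF : F.natDegree < M) {δ : ℝ}
    (hδ : δ ≠ 0) (x : ℝ) :
    ∑ j ∈ Finset.range M, (bernoulli j : ℝ) / (j.factorial : ℝ) * δ ^ j *
      ((derivative^[j] F).eval (x + δ) - (derivative^[j] F).eval x) =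
      δ * (derivative F).eval x := by
  have key : ∀ n < M, ∀ z : ℝ, ∑ j ∈ Finset.range M, (bernoulli j : ℝ) / (j.factorial : ℝ) * δ ^ j *
      (derivative^[j] (X ^ n : ℝ[X])).eval z = δ ^ n * bernoulliFun n (z / δ) := by
    intro n hn z
    rw [← sum_bernoulli_mul_choose_mul_pow n M hn, Finset.mul_sum]
    refine Finset.sum_congr rfl fun j _ => ?_
    rw [iterate_derivative_X_pow_eq_natCast_mul]
    rcases le_or_gt j n with hj | hj
    · have hfac : (j.factorial : ℝ) ≠ 0 := by positivity
      obtain ⟨i, rfl⟩ := Nat.exists_eq_add_of_le hj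
      simp only [Nat.descFactorial_eq_factorial_mul_choose, Nat.cast_mul, eval_mul, eval_natCast,
        eval_pow, eval_X, Nat.add_sub_cancel_left]
      field_simp
      rw [pow_add, div_pow]
      field_simp
    · simp [Nat.descFactorial_eq_zero_iff_lt.mpr hj, Nat.choose_eq_zero_of_lt hj]
  have mono : ∀ n < M, ∑ j ∈ Finset.range M, (bernoulli j : ℝ) / (j.factorial : ℝ) * δ ^ j *
      ((derivative^[j] (X ^ n : ℝ[X])).eval (x + δ) - (derivative^[j] (X ^ n : ℝ[X])).eval x) =
      δ * (derivative (X ^ n : ℝ[X])).eval x := by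
    intro n hn
    simp only [mul_sub, Finset.sum_sub_distrib]
    rw [key n hn, key n hn, ← mul_sub, add_div, div_self hδ, bernoulliFun_add_one]
    rcases n with _ | n
    · simp
    · simp only [derivative_X_pow, eval_mul, eval_pow, eval_X, eval_C, Nat.add_sub_cancel, div_pow]
      field_simp
      ring
  conv_lhs => rw [F.as_sum_range' M hF]
  conv_rhs => rw [F.as_sum_range' M hF]
  simp only [← C_mul_X_pow_eq_monomial, iterate_derivative_sum, iterate_derivative_C_mul,
    derivative_sum, derivative_C_mul, eval_finsetSum, eval_mul, eval_C]
  rw [Finset.mul_sum]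
  calc _ = ∑ j ∈ Finset.range M, ∑ n ∈ Finset.range M, F.coeff n *
        ((bernoulli j : ℝ) / (j.factorial : ℝ) * δ ^ j *
      ((derivative^[j] (X ^ n : ℝ[X])).eval (x + δ) - (derivative^[j] (X ^ n : ℝ[X])).eval x)) := by
        refine Finset.sum_congr rfl fun j _ => ?_
        rw [← Finset.sum_sub_distrib, Finset.mul_sum]
        exact Finset.sum_congr rfl fun n _ => by ring
    _ = _ := by
        rw [Finset.sum_comm]
        refine Finset.sum_congr rfl fun n hn => ?_
        rw [← Finset.mul_sum, mono n (Finset.mem_range.mp hn)]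
        ring

open Polynomial in
/-- The composite Euler–Maclaurin formula for polynomials. -/
theorem euler_maclaurin_polynomial (F : ℝ[X]) (M : ℕ) (hF : F.natDegree < M) {δ : ℝ}
    (hδ : δ ≠ 0) (a : ℝ) (N : ℕ) :
    ∑ j ∈ Finset.range M, (bernoulli j : ℝ) / (j.factorial : ℝ) * δ ^ j *
      ((derivative^[j] F).eval (a + N * δ) - (derivative^[j] F).eval a) =
      δ * ∑ k ∈ Finset.range N, (derivative F).eval (a + k * δ) := by
  induction N with
  | zero => simp
  | succ N ih =>
    rw [Finset.sum_range_succ, mul_add, ← ih,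
      ← euler_maclaurin_polynomial_step F M hF hδ (a + N * δ), ← Finset.sum_add_distrib]
    refine Finset.sum_congr rfl fun j _ => ?_
    rw [show a + ((N + 1 : ℕ) : ℝ) * δ = a + N * δ + δ by push_cast; ring]
    ring

theorem abs_bernoulli_two_mul_div_factorial_le (s : ℕ) (hs : s ≠ 0) :
    |(bernoulli (2 * s) : ℝ) / ((2 * s).factorial : ℝ)| ≤ 4 / (2 * Real.pi) ^ (2 * s) := by
  have h := hasSum_zeta_nat hs
  have hle : (-1 : ℝ) ^ (s + 1) * 2 ^ (2 * s - 1) * Real.pi ^ (2 * s) * (bernoulli (2 * s) : ℝ) /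
      ((2 * s).factorial : ℝ) ≤ Real.pi ^ 2 / 6 := by
    refine hasSum_le (fun n => ?_) h hasSum_zeta_two
    rcases n.eq_zero_or_pos with rfl | hn
    · simp [hs]
    · have h1 : (1 : ℝ) ≤ n := by exact_mod_cast hn
      gcongr
      · omega
  have hnn := h.nonneg fun n => by positivity
  have h2 : Real.pi ^ 2 / 6 ≤ 2 := by nlinarith [Real.pi_lt_d2, Real.pi_pos]
  have habs : |(-1 : ℝ) ^ (s + 1) * 2 ^ (2 * s - 1) * Real.pi ^ (2 * s) *
      (bernoulli (2 * s) : ℝ) / ((2 * s).factorial : ℝ)| ≤ 2 := by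
    rw [abs_of_nonneg hnn]; linarith
  rw [mul_div_assoc, abs_mul, abs_mul, abs_mul, abs_neg_one_pow, one_mul,
    abs_of_pos (by positivity : (0 : ℝ) < 2 ^ (2 * s - 1)),
    abs_of_pos (by positivity : (0 : ℝ) < Real.pi ^ (2 * s))] at habs
  rw [le_div_iff₀ (by positivity), mul_pow,
    show (2 : ℝ) ^ (2 * s) = 2 * 2 ^ (2 * s - 1) by rw [← pow_succ']; congr 1; omega]
  linarith

theorem legendre_eval_one (n : ℕ) : (legendre n).eval 1 = 1 := by
  induction n using Nat.twoStepInduction with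
  | zero => simp [legendre]
  | one => simp [legendre]
  | more n h0 h1 =>
    simp only [legendre, Polynomial.eval_sub, Polynomial.eval_mul, Polynomial.eval_C,
      Polynomial.eval_X, h0, h1]
    field_simp
    ring

theorem legendre_eval_neg_one (n : ℕ) : (legendre n).eval (-1) = (-1) ^ n := by
  induction n using Nat.twoStepInduction with
  | zero => simp [legendre]
  | one => simp [legendre]
  | more n h0 h1 =>
    simp only [legendre, Polynomial.eval_sub, Polynomial.eval_mul, Polynomial.eval_C,
      Polynomial.eval_X, h0, h1]
    field_simp
    ring

theorem natDegree_legendre_le (n : ℕ) : (legendre n).natDegree ≤ n := by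
  induction n using Nat.twoStepInduction with
  | zero => simp [legendre]
  | one => simp [legendre]
  | more n h0 h1 =>
    rw [legendre]
    refine (Polynomial.natDegree_sub_le _ _).trans (max_le ?_ ?_)
    · refine (Polynomial.natDegree_C_mul_le _ _).trans (Polynomial.natDegree_mul_le.trans ?_)
      rw [Polynomial.natDegree_X]
      omega
    · exact (Polynomial.natDegree_C_mul_le _ _).trans (by omega)

theorem legendre_consecutive_quadratic_form_le (n : ℕ) (x : ℝ) :
    ((legendre n).eval x - x * (legendre (n + 1)).eval x) ^ 2 +
      (1 - x ^ 2) * (legendre (n + 1)).eval x ^ 2 ≤ 1 - x ^ 2 := by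
  induction n with
  | zero =>
    simp only [legendre, Polynomial.eval_one, Polynomial.eval_X]
    nlinarith
  | succ n ih =>
    refine le_trans ?_ ih
    set u := (legendre n).eval x
    set v := (legendre (n + 1)).eval x
    set r : ℝ := ((n : ℝ) + 1) / (n + 2) with hr
    have hr0 : 0 ≤ r := by positivity
    have hr1 : r ≤ 1 := by rw [hr, div_le_one (by positivity)]; linarith
    have hw : (legendre (n + 1 + 1)).eval x = x * v + r * (x * v - u) := by
      simp only [legendre, Polynomial.eval_sub, Polynomial.eval_mul, Polynomial.eval_C,
        Polynomial.eval_X]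
      rw [hr]
      field_simp
      ring
    rw [hw]
    have hr2 : r ^ 2 ≤ 1 := by nlinarith
    nlinarith [mul_nonneg (sub_nonneg.2 hr2) (sq_nonneg (u - x * v))]

theorem abs_legendre_eval_le_one (n : ℕ) {x : ℝ} (hx : x ∈ Set.Icc (-1 : ℝ) 1) :
    |(legendre n).eval x| ≤ 1 := by
  rcases eq_or_lt_of_le hx.1 with rfl | h1
  · simp [legendre_eval_neg_one]
  rcases eq_or_lt_of_le hx.2 with rfl | h2
  · simp [legendre_eval_one]
  have hx2 : 0 < 1 - x ^ 2 := by nlinarith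
  rcases n with _ | n
  · simp [legendre]
  · have h := legendre_consecutive_quadratic_form_le n x
    rw [← sq_le_one_iff_abs_le_one]
    refine le_of_mul_le_mul_left ?_ hx2
    nlinarith [sq_nonneg ((legendre n).eval x - x * (legendre (n + 1)).eval x)]

open Polynomial in
/-- V. A. Markov's inequality at the endpoint `1`. -/
theorem abs_iterate_derivative_eval_one_le {P : ℝ[X]} {d : ℕ} (hdeg : P.natDegree ≤ d)
    (hP : ∀ x ∈ Set.Icc (-1 : ℝ) 1, |P.eval x| ≤ 1) (k : ℕ) :
    |(derivative^[k] P).eval 1| ≤ (derivative^[k] (Chebyshev.T ℝ d)).eval 1 := by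
  have hdeg' : P.degree ≤ d := natDegree_le_iff_degree_le.mp hdeg
  refine abs_le'.mpr
    ⟨Chebyshev.eval_iterate_derivative_le_of_forall_abs_le_one le_rfl hdeg' hP, ?_⟩
  have := Chebyshev.eval_iterate_derivative_le_of_forall_abs_le_one (P := -P) (k := k) le_rfl
    (by rwa [degree_neg]) (by simpa using hP)
  simpa [iterate_derivative_neg] using this

open Polynomial in
theorem iterate_derivative_comp_neg_X_eval (P : ℝ[X]) (k : ℕ) (x : ℝ) :
    (derivative^[k] (P.comp (-X))).eval x = (-1) ^ k * (derivative^[k] P).eval (-x) := by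
  induction k generalizing P with
  | zero => simp
  | succ k ih =>
    rw [Function.iterate_succ_apply, derivative_comp, derivative_neg, derivative_X, neg_one_mul,
      iterate_derivative_neg, eval_neg, ih, Function.iterate_succ_apply]
    ring

open Polynomial in
/-- V. A. Markov's inequality at the endpoint `-1`. -/
theorem abs_iterate_derivative_eval_neg_one_le {P : ℝ[X]} {d : ℕ} (hdeg : P.natDegree ≤ d)
    (hP : ∀ x ∈ Set.Icc (-1 : ℝ) 1, |P.eval x| ≤ 1) (k : ℕ) :
    |(derivative^[k] P).eval (-1)| ≤ (derivative^[k] (Chebyshev.T ℝ d)).eval 1 := by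
  have h := abs_iterate_derivative_eval_one_le (P := P.comp (-X)) (d := d)
    (by rwa [natDegree_comp, natDegree_neg, natDegree_X, mul_one])
    (fun x hx => by
      rw [eval_comp, eval_neg, eval_X]
      exact hP (-x) ⟨by linarith [hx.2], by linarith [hx.1]⟩) k
  rwa [iterate_derivative_comp_neg_X_eval, abs_mul, abs_neg_one_pow, one_mul] at h

open Polynomial in
theorem iterate_derivative_T_eval_one_nonneg (d k : ℕ) :
    0 ≤ (derivative^[k] (Chebyshev.T ℝ d)).eval 1 :=
  (abs_nonneg _).trans (Chebyshev.abs_iterate_derivative_T_real_le d k (x := 1) (by simp))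

open Polynomial in
theorem iterate_derivative_T_eval_one_succ_le (d k : ℕ) :
    (2 * k + 1) * (derivative^[k + 1] (Chebyshev.T ℝ d)).eval 1 ≤
      (d : ℝ) ^ 2 * (derivative^[k] (Chebyshev.T ℝ d)).eval 1 := by
  have h := Chebyshev.iterate_derivative_T_eval_one_recurrence (R := ℝ) d k
  rw [h, Int.cast_natCast]
  exact mul_le_mul_of_nonneg_right (by nlinarith [sq_nonneg (k : ℝ)])
    (iterate_derivative_T_eval_one_nonneg d k)

open Polynomial in
theorem iterate_derivative_T_eval_one_add_two_le (d s : ℕ) :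
    15 * (derivative^[2 * s + 3] (Chebyshev.T ℝ d)).eval 1 ≤
      (d : ℝ) ^ 4 * (derivative^[2 * s + 1] (Chebyshev.T ℝ d)).eval 1 := by
  have h1 := iterate_derivative_T_eval_one_succ_le d (2 * s + 1)
  have h2 := iterate_derivative_T_eval_one_succ_le d (2 * s + 2)
  have n2 := iterate_derivative_T_eval_one_nonneg d (2 * s + 1 + 1)
  have n3 := iterate_derivative_T_eval_one_nonneg d (2 * s + 2 + 1)
  push_cast at h1 h2
  have hs : (0 : ℝ) ≤ s := s.cast_nonneg
  have h1' : 3 * (derivative^[2 * s + 1 + 1] (Chebyshev.T ℝ d)).eval 1 ≤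
      (d : ℝ) ^ 2 * (derivative^[2 * s + 1] (Chebyshev.T ℝ d)).eval 1 := by
    nlinarith [mul_nonneg hs n2]
  have h2' : 5 * (derivative^[2 * s + 2 + 1] (Chebyshev.T ℝ d)).eval 1 ≤
      (d : ℝ) ^ 2 * (derivative^[2 * s + 1 + 1] (Chebyshev.T ℝ d)).eval 1 := by
    nlinarith [mul_nonneg hs n3]
  have := mul_le_mul_of_nonneg_left h1' (sq_nonneg (d : ℝ))
  change 15 * (derivative^[2 * s + 2 + 1] (Chebyshev.T ℝ d)).eval 1 ≤ _
  nlinarith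

theorem abs_sum_range_two_mul_le_of_geometric {t b : ℕ → ℝ} (hodd : ∀ s, t (2 * s + 1) = 0)
    (heven : ∀ s, |t (2 * s)| ≤ b s) (hb : ∀ s, b (s + 1) ≤ b s / 8) (K : ℕ) :
    |∑ j ∈ Finset.range (2 * K), t j| ≤ 8 / 7 * b 0 := by
  have h : |∑ j ∈ Finset.range (2 * K), t j| ≤ 8 / 7 * (b 0 - b K) := by
    induction K with
    | zero => simp
    | succ K ih =>
      rw [show 2 * (K + 1) = 2 * K + 1 + 1 by ring, Finset.sum_range_succ, Finset.sum_range_succ,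
        hodd, add_zero]
      have := abs_add_le (∑ j ∈ Finset.range (2 * K), t j) (t (2 * K))
      linarith [heven K, hb K]
  linarith [(abs_nonneg _).trans (heven K)]

open Polynomial in
theorem exists_derivative_eq (h : ℝ[X]) {d : ℕ} (hd : h.natDegree ≤ d) :
    ∃ F : ℝ[X], derivative F = h ∧ F.natDegree ≤ d + 1 := by
  refine ⟨∑ i ∈ Finset.range (d + 1), C (h.coeff i / (i + 1)) * X ^ (i + 1), ?_, ?_⟩
  · conv_rhs => rw [h.as_sum_range' (d + 1) (by omega)]
    rw [derivative_sum]
    refine Finset.sum_congr rfl fun i _ => ?_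
    rw [derivative_C_mul_X_pow, C_mul_X_pow_eq_monomial]
    congr 1
    push_cast
    field_simp
  · refine natDegree_sum_le_of_forall_le _ _ fun i hi => ?_
    exact (natDegree_C_mul_X_pow_le _ _).trans
      (by simpa using Nat.lt_succ_iff.mp (Finset.mem_range.mp hi))

open Polynomial in
/-- The trapezium rule error for a polynomial, expanded in endpoint derivatives. -/
theorem trapezium_error_eq_sum (h : ℝ[X]) (N d K : ℕ) (hN : N ≠ 0) (hd : h.natDegree ≤ d)
    (hK : d < 2 * K) :
    2 / (N : ℝ) * ∑ k : Fin (N + 1), h.eval (xequi N k) -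
        2 / (N : ℝ) * ((h.eval 1 + h.eval (-1)) / 2) - ∫ x in (-1 : ℝ)..1, h.eval x =
      ∑ j ∈ Finset.range (2 * K), (bernoulli (j + 2) : ℝ) / ((j + 2).factorial : ℝ) *
        (2 / (N : ℝ)) ^ (j + 2) *
          ((derivative^[j + 1] h).eval 1 - (derivative^[j + 1] h).eval (-1)) := by
  obtain ⟨F, rfl, hFd⟩ := exists_derivative_eq h hd
  have hN' : (N : ℝ) ≠ 0 := by exact_mod_cast hN
  have hint : ∫ x in (-1 : ℝ)..1, (derivative F).eval x = F.eval 1 - F.eval (-1) :=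
    intervalIntegral.integral_eq_sub_of_hasDerivAt (fun x _ => F.hasDerivAt x)
      ((derivative F).continuous.intervalIntegrable _ _)
  have hem := euler_maclaurin_polynomial F (2 * K + 2) (by omega)
    (div_ne_zero two_ne_zero hN' : (2 / (N : ℝ)) ≠ 0) (-1) N
  have hone : (-1 : ℝ) + N * (2 / N) = 1 := by field_simp; norm_num
  have hsum : ∑ k : Fin (N + 1), (derivative F).eval (xequi N k) =
      ∑ k ∈ Finset.range N, (derivative F).eval (-1 + k * (2 / (N : ℝ))) +
        (derivative F).eval 1 := by
    nth_rewrite 2 [← hone]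
    rw [← Finset.sum_range_succ (fun k : ℕ => (derivative F).eval (-1 + k * (2 / (N : ℝ)))),
      ← Fin.sum_univ_eq_sum_range (fun k : ℕ => (derivative F).eval (-1 + k * (2 / (N : ℝ))))]
    refine Finset.sum_congr rfl fun k _ => ?_
    rw [xequi]
    congr 1
    ring
  rw [hone, Finset.sum_range_succ', Finset.sum_range_succ'] at hem
  simp only [Function.iterate_succ_apply, Function.iterate_zero_apply, zero_add, _root_.bernoulli_zero,
    _root_.bernoulli_one, add_assoc, Nat.reduceAdd, Nat.factorial_one, Nat.factorial_zero] at hem ⊢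
  push_cast at hem
  rw [hsum, hint, mul_add, ← hem]
  ring

/-- The trapezium rule error for a polynomial bounded by `1` on `[-1, 1]`. -/
theorem abs_trapezium_error_le (h : Polynomial ℝ) (N d : ℕ) (hN : N ≠ 0)
    (hd : h.natDegree ≤ d) (hdN : (d : ℝ) ^ 2 ≤ 4 * N)
    (hbd : ∀ x ∈ Set.Icc (-1 : ℝ) 1, |h.eval x| ≤ 1) :
    |2 / (N : ℝ) * ∑ k : Fin (N + 1), h.eval (xequi N k) -
        2 / (N : ℝ) * ((h.eval 1 + h.eval (-1)) / 2) - ∫ x in (-1 : ℝ)..1, h.eval x| ≤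
      3 * (d : ℝ) ^ 2 / (Real.pi * (N : ℝ) ^ 2) := by
  have hN' : (0 : ℝ) < N := by exact_mod_cast Nat.pos_of_ne_zero hN
  have hpi := Real.pi_pos
  have hpi3 := Real.pi_gt_d2
  rw [trapezium_error_eq_sum h N d (d + 1) hN hd (by omega)]
  refine (abs_sum_range_two_mul_le_of_geometric
    (b := fun s => 8 / (Real.pi * N) ^ (2 * s + 2) *
      (Polynomial.derivative^[2 * s + 1] (Polynomial.Chebyshev.T ℝ d)).eval 1)
    (fun s => ?_) (fun s => ?_) (fun s => ?_) _).trans ?_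
  · rw [bernoulli_eq_zero_of_odd ⟨s + 1, by ring⟩ (by omega)]
    simp
  · have hB := abs_bernoulli_two_mul_div_factorial_le (s + 1) (by omega)
    have hD : |(Polynomial.derivative^[2 * s + 1] h).eval 1 -
        (Polynomial.derivative^[2 * s + 1] h).eval (-1)| ≤
        2 * (Polynomial.derivative^[2 * s + 1] (Polynomial.Chebyshev.T ℝ d)).eval 1 := by
      have := abs_sub ((Polynomial.derivative^[2 * s + 1] h).eval 1)
        ((Polynomial.derivative^[2 * s + 1] h).eval (-1))
      linarith [abs_iterate_derivative_eval_one_le hd hbd (2 * s + 1),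
        abs_iterate_derivative_eval_neg_one_le hd hbd (2 * s + 1)]
    rw [show 2 * (s + 1) = 2 * s + 2 by ring] at hB
    rw [abs_mul, abs_mul, abs_of_pos (by positivity : (0 : ℝ) < (2 / (N : ℝ)) ^ (2 * s + 2))]
    refine (mul_le_mul (mul_le_mul_of_nonneg_right hB (by positivity)) hD (abs_nonneg _)
      (by positivity)).trans_eq ?_
    simp only [mul_pow, div_pow]
    field_simp
    ring
  · have hT := iterate_derivative_T_eval_one_add_two_le d s
    have hT0 := iterate_derivative_T_eval_one_nonneg d (2 * s + 1)
    have hd4 : (d : ℝ) ^ 4 ≤ 16 * (N : ℝ) ^ 2 := by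
      nlinarith [mul_self_le_mul_self (sq_nonneg (d : ℝ)) hdN]
    have hle : (Polynomial.derivative^[2 * s + 3] (Polynomial.Chebyshev.T ℝ d)).eval 1 ≤
        (Real.pi * N) ^ 2 / 8 *
          (Polynomial.derivative^[2 * s + 1] (Polynomial.Chebyshev.T ℝ d)).eval 1 := by
      have hpi9 : 9 ≤ Real.pi ^ 2 := by nlinarith
      have h9 : (d : ℝ) ^ 4 ≤ 15 * ((Real.pi * N) ^ 2 / 8) := by
        rw [mul_pow]
        nlinarith [mul_le_mul_of_nonneg_right hpi9 (sq_nonneg (N : ℝ))]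
      nlinarith [mul_le_mul_of_nonneg_right h9 hT0]
    show 8 / (Real.pi * N) ^ (2 * s + 2 + 2) *
      (Polynomial.derivative^[2 * s + 3] (Polynomial.Chebyshev.T ℝ d)).eval 1 ≤ _
    refine (mul_le_mul_of_nonneg_left hle (by positivity)).trans_eq ?_
    rw [pow_add _ (2 * s + 2) 2]
    field_simp
  · have hT : (Polynomial.derivative^[1] (Polynomial.Chebyshev.T ℝ d)).eval 1 ≤ (d : ℝ) ^ 2 := by
      simpa using iterate_derivative_T_eval_one_succ_le d 0
    show 8 / 7 * (8 / (Real.pi * N) ^ 2 *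
      (Polynomial.derivative^[1] (Polynomial.Chebyshev.T ℝ d)).eval 1) ≤ _
    calc _ ≤ 8 / 7 * (8 / (Real.pi * N) ^ 2 * (d : ℝ) ^ 2) := by gcongr
      _ = (64 / 7 / Real.pi) * ((d : ℝ) ^ 2 / (Real.pi * (N : ℝ) ^ 2)) := by field_simp; ring
      _ ≤ 3 * ((d : ℝ) ^ 2 / (Real.pi * (N : ℝ) ^ 2)) := by
          gcongr
          rw [div_le_iff₀ hpi]
          linarith
      _ = _ := by ring

/-- **The trapezium-rule error bound from the proof of Theorem 3.1 of the paper**: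
for `N ≥ 4` and `(m+n)² ≤ 4N`, the error of the `(N+1)`-point trapezium rule for
`∫_{-1}^1 P_m P_n`, namely
`E_{mn} = (2/N) Σ_k P_m(x_k)P_n(x_k) − (2/N)χ_even(m+n) − ∫_{-1}^1 P_m P_n`,
satisfies `|E_{mn}| ≤ 3(m+n)²/(πN²)`. -/
theorem legendre_trapezium_error_bound (N m n : ℕ) (hN : 4 ≤ N)
    (hmn : ((m : ℝ) + (n : ℝ)) ^ 2 ≤ 4 * (N : ℝ)) :
    |2 / (N : ℝ) *
          ∑ k : Fin (N + 1), (legendre m).eval (xequi N k) * (legendre n).eval (xequi N k) -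
        2 / (N : ℝ) * (if (m + n) % 2 = 0 then (1 : ℝ) else 0) -
        ∫ x in (-1 : ℝ)..1, (legendre m).eval x * (legendre n).eval x| ≤
      3 * ((m : ℝ) + (n : ℝ)) ^ 2 / (Real.pi * (N : ℝ) ^ 2) := by
  have hmul : ∀ x, (legendre m * legendre n).eval x = (legendre m).eval x * (legendre n).eval x :=
    fun x => Polynomial.eval_mul
  have h := abs_trapezium_error_le (legendre m * legendre n) N (m + n) (by omega)
    (Polynomial.natDegree_mul_le.trans
      (add_le_add (natDegree_legendre_le m) (natDegree_legendre_le n)))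
    (by exact_mod_cast hmn)
    (fun x hx => by
      rw [hmul, abs_mul]
      exact mul_le_one₀ (abs_legendre_eval_le_one m hx) (abs_nonneg _)
        (abs_legendre_eval_le_one n hx))
  have hend : ((legendre m).eval 1 * (legendre n).eval 1 +
      (legendre m).eval (-1) * (legendre n).eval (-1)) / 2 =
      if (m + n) % 2 = 0 then (1 : ℝ) else 0 := by
    rw [legendre_eval_one, legendre_eval_one, legendre_eval_neg_one, legendre_eval_neg_one,
      ← pow_add]
    split_ifs with hpar
    · rw [(Nat.even_iff.mpr hpar).neg_one_pow]
      norm_num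
    · rw [(Nat.odd_iff.mpr (by omega)).neg_one_pow]
      norm_num
  simp only [hmul] at h
  rwa [hend, Nat.cast_add] at h
end
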